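/- For all sufficiently large n, there exists a bipartite graph G with both parts of size n which is (n−2)-regular, together with an edge-colouring of G using n−2 colours in which every colour is used on exactly n edges (so each colour is used on more than Δ(G) + 1 edges), such that G has no rainbow matching of size at least n − (1/42)·ln n; in particular, G has no rainbow matching using every colour. (This disproves the conjecture of Aharoni, Barát and Wanless that every bipartite graph with more than Δ(G) + 1 edges of each colour has a rainbow matching using every colour.) -/

import Mathlib

namespace ABW
open Finset

theorem color_lemma {α V : Type*} [DecidableEq α] [DecidableEq V] (n : ℕ) (hn : 0 < n)
    (lab : α → V) : ∀ (m : ℕ) (E : Finset α) (f : V → ℕ), E.card = n * m →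
    (∀ v, n * f v ≤ (E.filter (fun e => lab e = v)).card) →
    ∃ (c : α → ℕ) (w : ℕ → Option V), (∀ e ∈ E, c e < m) ∧
      (∀ k < m, (E.filter (fun e => c e = k)).card = n) ∧
      (∀ e ∈ E, ∀ v, w (c e) = some v → lab e = v) ∧
      (∀ v, ((range m).filter (fun k => w k = some v)).card = f v) := by
  intro m
  induction m with
  | zero =>
    intro E f hE hf
    have hE0 : E = ∅ := by simpa using hE
    subst hE0
    refine ⟨fun _ => 0, fun _ => none, by simp, by simp, by simp, ?_⟩
    intro v
    have := hf v
    simp at this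
    simp
    omega
  | succ m ih =>
    intro E f hE hf
    -- choose a set A of n edges, and tag u
    have key : ∃ (A : Finset α) (u : Option V) (g : V → ℕ), A ⊆ E ∧ A.card = n ∧
        (∀ e ∈ A, ∀ v, u = some v → lab e = v) ∧
        (∀ v, n * g v ≤ ((E \ A).filter (fun e => lab e = v)).card) ∧
        (∀ v, f v = g v + if u = some v then 1 else 0) := by
      by_cases h : ∃ v, 0 < f v
      · obtain ⟨v, hv⟩ := h
        have h1 : n ≤ (E.filter (fun e => lab e = v)).card :=
          le_trans (Nat.le_mul_of_pos_right n hv) (hf v)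
        obtain ⟨A, hA, hAc⟩ := exists_subset_card_eq h1
        refine ⟨A, some v, Function.update f v (f v - 1), hA.trans (filter_subset _ _), hAc, ?_, ?_, ?_⟩
        · intro e he v' hv'
          have := (mem_filter.1 (hA he)).2
          simp at hv'; rw [← hv']; exact this
        · intro v'
          by_cases hvv : v' = v
          · subst hvv
            have : (E \ A).filter (fun e => lab e = v') = (E.filter (fun e => lab e = v')) \ A := by
              ext e; simp; tauto
            rw [this, card_sdiff_of_subset hA, hAc]
            simp only [Function.update_self, Nat.mul_sub, mul_one]
            have := hf v'
            omega
          · have : (E \ A).filter (fun e => lab e = v') = (E.filter (fun e => lab e = v')) := by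
              ext e
              simp only [mem_filter, mem_sdiff]
              constructor
              · tauto
              · rintro ⟨a1, a2⟩
                refine ⟨⟨a1, fun h => hvv ?_⟩, a2⟩
                rw [← a2]; exact (mem_filter.1 (hA h)).2
            rw [this, Function.update_of_ne hvv]; exact hf v'
        · intro v'
          by_cases hvv : v' = v
          · subst hvv; simp; omega
          · simp [Function.update_of_ne hvv, Ne.symm hvv]
      · push Not at h
        have h1 : n ≤ E.card := by rw [hE]; exact Nat.le_mul_of_pos_right n (by omega)
        obtain ⟨A, hA, hAc⟩ := exists_subset_card_eq h1
        refine ⟨A, none, f, hA, hAc, by simp, ?_, by simp⟩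
        intro v
        have : f v = 0 := by have := h v; omega
        simp [this]
    obtain ⟨A, u, g, hA, hAc, hAl, hg, hfg⟩ := key
    obtain ⟨c, w, h1, h2, h3, h4⟩ := ih (E \ A) g (by
      rw [card_sdiff_of_subset hA, hE, hAc, Nat.mul_succ]; omega) hg
    refine ⟨fun e => if e ∈ A then m else c e, Function.update w m u, ?_, ?_, ?_, ?_⟩
    · intro e he
      by_cases hea : e ∈ A
      · simp [hea]
      · have := h1 e (by simp [he, hea])
        simp [hea]; omega
    · intro k hk
      by_cases hkm : k = m
      · subst hkm
        rw [← hAc]; congr 1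
        ext e
        simp only [mem_filter]
        constructor
        · rintro ⟨he, h⟩
          by_contra hea
          have := h1 e (by simp [he, hea])
          simp [hea] at h; omega
        · intro h; simp [hA h, h]
      · rw [← h2 k (by omega)]; congr 1
        ext e
        simp only [mem_filter, mem_sdiff]
        by_cases hea : e ∈ A
        · simp [hea]; omega
        · simp [hea]
    · intro e he v
      by_cases hea : e ∈ A
      · simp [hea]; exact hAl e hea v
      · have hh := h1 e (by simp [he, hea])
        simp only [hea, if_false]
        rw [Function.update_of_ne (by omega)]
        exact h3 e (by simp [he, hea]) v
    · intro v
      rw [hfg v, ← h4 v, range_add_one, filter_insert]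
      have : (range m).filter (fun k => Function.update w m u k = some v) =
          (range m).filter (fun k => w k = some v) := by
        apply filter_congr
        intro k hk
        rw [Function.update_of_ne (by simp at hk; omega)]
      rw [this]
      simp only [Function.update_self]
      split_ifs with h
      · rw [card_insert_of_notMem (by simp)]
      · rfl

/-- interval labelling -/
theorem label_lemma (x : ℕ → ℕ) (k : ℕ) : ∃ L : ℕ → ℕ, (∀ a, L a ≤ k) ∧
    (∀ a, L a < k ↔ a < ∑ i ∈ range k, x i) ∧
    (∀ i < k, ((range (∑ i ∈ range k, x i)).filter (fun a => L a = i)).card = x i) := by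
  induction k with
  | zero => exact ⟨fun _ => 0, by simp⟩
  | succ k ih =>
    obtain ⟨L, h1, h2, h3⟩ := ih
    rw [sum_range_succ]
    set X := ∑ i ∈ range k, x i with hX
    refine ⟨fun a => if a < X + x k then L a else k + 1, ?_, ?_, ?_⟩
    · intro a; have := h1 a; dsimp only; split_ifs <;> omega
    · intro a; have := h1 a; dsimp only; split_ifs <;> omega
    · intro i hi
      by_cases hik : i = k
      · subst hik
        have : (range (X + x i)).filter (fun a => (if a < X + x i then L a else i + 1) = i)
            = Ico X (X + x i) := by
          ext a
          have e1 := h1 a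
          have e2 := h2 a
          simp only [mem_filter, mem_range, mem_Ico]
          split_ifs <;> omega
        rw [this]; simp
      · rw [← h3 i (by omega)]
        congr 1
        ext a
        have e1 := h1 a
        have e2 := h2 a
        simp only [mem_filter, mem_range]
        split_ifs <;> omega

/-- parity argument -/
theorem match_lemma (n m k q : ℕ) (r s : Fin n → ℕ) (col : Fin n × Fin n → ℕ)
    (w : ℕ → Option (ℕ × ℕ)) (M : Finset (Fin n × Fin n))
    (hcol : ∀ p ∈ M, col p < m)
    (hw : ∀ p ∈ M, ∀ v, w (col p) = some v → ∀ l, 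
      ((if r p.1 = l then 1 else 0) + (if s p.2 = l then 1 else 0) : ZMod 2) =
      (if v.1 = l then 1 else 0) + (if v.2 = l then 1 else 0))
    (hM1 : Set.InjOn Prod.fst (M : Set (Fin n × Fin n)))
    (hM2 : Set.InjOn Prod.snd (M : Set (Fin n × Fin n)))
    (hM3 : Set.InjOn col (M : Set (Fin n × Fin n)))
    (hq : ((range m).filter (fun κ => w κ = none)).card ≤ q)
    (hodd : ∀ l < k, (∑ a, (if r a = l then 1 else 0) + ∑ a, (if s a = l then 1 else 0) +
      ∑ κ ∈ range m, ((w κ).elim 0 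
        fun v => (if v.1 = l then 1 else 0) + (if v.2 = l then 1 else 0)) : ZMod 2) = 1) :
    k + 4 * M.card ≤ 2 * n + 2 * m + 2 * q := by
  classical
  set RM : Finset (Fin n) := univ \ M.image Prod.fst with hRM
  set SM : Finset (Fin n) := univ \ M.image Prod.snd with hSM
  set CM : Finset ℕ := range m \ M.image col with hCM
  set JM := M.filter (fun p => w (col p) = none) with hJM
  have hCsub : M.image col ⊆ range m := by
    intro κ hκ
    obtain ⟨p, hp, rfl⟩ := mem_image.1 hκ
    simpa using hcol p hp
  have cR : RM.card + M.card = n := by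
    rw [hRM, card_sdiff_of_subset (subset_univ _), card_image_of_injOn hM1]
    have : M.card ≤ n := by
      rw [← card_image_of_injOn hM1]; simpa using card_le_univ (M.image Prod.fst)
    simp; omega
  have cS : SM.card + M.card = n := by
    rw [hSM, card_sdiff_of_subset (subset_univ _), card_image_of_injOn hM2]
    have : M.card ≤ n := by
      rw [← card_image_of_injOn hM2]; simpa using card_le_univ (M.image Prod.snd)
    simp; omega
  have cC : CM.card + M.card = m := by
    have : M.card ≤ m := by
      rw [← card_image_of_injOn hM3]; simpa using card_le_card hCsub
    rw [hCM, card_sdiff_of_subset hCsub, card_image_of_injOn hM3]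
    simp; omega
  have cJ : JM.card ≤ q := by
    refine le_trans ?_ hq
    have hJs : (JM : Set (Fin n × Fin n)) ⊆ M := by
      rw [hJM]; exact_mod_cast filter_subset _ _
    rw [← card_image_of_injOn (hM3.mono hJs)]
    apply card_le_card
    intro κ hκ
    obtain ⟨p, hp, rfl⟩ := mem_image.1 hκ
    simp [hJM] at hp
    simp [hcol p hp.1, hp.2]
  have cover : range k ⊆ (RM.image r ∪ SM.image s) ∪ 
      (CM.biUnion (fun κ => (w κ).elim ∅ (fun v => {v.1, v.2})) ∪ 
        JM.biUnion (fun p => {r p.1, s p.2})) := by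
    intro l hl
    by_contra hcon
    simp only [mem_union, not_or] at hcon
    obtain ⟨⟨n1, n2⟩, n3, n4⟩ := hcon
    have ho := hodd l (mem_range.1 hl)
    have e1 : (∑ a, (if r a = l then 1 else 0) : ZMod 2) = 
        ∑ p ∈ M, if r p.1 = l then 1 else 0 := by
      rw [← sum_image (f := fun a => (if r a = l then 1 else 0 : ZMod 2)) hM1]
      symm
      apply sum_subset (subset_univ _)
      intro a _ ha
      rw [if_neg]
      intro h
      exact n1 (mem_image.2 ⟨a, by simp only [hRM, mem_sdiff]; exact ⟨mem_univ _, ha⟩, h⟩)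
    have e2 : (∑ a, (if s a = l then 1 else 0) : ZMod 2) = 
        ∑ p ∈ M, if s p.2 = l then 1 else 0 := by
      rw [← sum_image (f := fun a => (if s a = l then 1 else 0 : ZMod 2)) hM2]
      symm
      apply sum_subset (subset_univ _)
      intro a _ ha
      rw [if_neg]
      intro h
      exact n2 (mem_image.2 ⟨a, by simp only [hSM, mem_sdiff]; exact ⟨mem_univ _, ha⟩, h⟩)
    have e3 : (∑ κ ∈ range m, ((w κ).elim 0 
        fun v => (if v.1 = l then 1 else 0) + (if v.2 = l then 1 else 0)) : ZMod 2) = 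
        ∑ p ∈ M, ((w (col p)).elim 0 
        fun v => (if v.1 = l then 1 else 0) + (if v.2 = l then 1 else 0)) := by
      rw [← sum_image (f := fun κ => ((w κ).elim 0 
        fun v => (if v.1 = l then 1 else 0) + (if v.2 = l then 1 else 0) : ZMod 2)) hM3]
      symm
      apply sum_subset hCsub
      intro κ hκ1 hκ
      have hκC : κ ∈ CM := by simp only [hCM, mem_sdiff]; exact ⟨hκ1, hκ⟩
      have : l ∉ (w κ).elim ∅ (fun v => ({v.1, v.2} : Finset ℕ)) := fun h => 
        n3 (mem_biUnion.2 ⟨κ, hκC, h⟩)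
      rcases hwk : w κ with _ | v
      · simp
      · rw [hwk] at this
        simp at this
        simp [Ne.symm this.1, Ne.symm this.2]
    rw [e1, e2, e3, ← sum_add_distrib, ← sum_add_distrib] at ho
    rw [sum_eq_zero] at ho
    · exact absurd ho (by decide)
    · intro p hp
      rcases hwk : w (col p) with _ | v
      · have : l ∉ ({r p.1, s p.2} : Finset ℕ) := fun h => 
          n4 (mem_biUnion.2 ⟨p, by simp only [hJM, mem_filter]; exact ⟨hp, hwk⟩, h⟩)
        simp at this
        simp [Ne.symm this.1, Ne.symm this.2]
      · rw [hw p hp v hwk l]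
        simp only [Option.elim]
        exact CharTwo.add_self_eq_zero _
  have c1 := card_le_card cover
  have c2 : (RM.image r).card ≤ RM.card := card_image_le
  have c3 : (SM.image s).card ≤ SM.card := card_image_le
  have c4 : (CM.biUnion (fun κ => (w κ).elim ∅ (fun v => ({v.1, v.2} : Finset ℕ)))).card ≤ CM.card * 2 := by
    apply card_biUnion_le_card_mul
    intro κ _
    rcases w κ with _ | v
    · simp
    · exact card_le_two
  have c5 : (JM.biUnion (fun p => ({r p.1, s p.2} : Finset ℕ))).card ≤ JM.card * 2 := by
    apply card_biUnion_le_card_mul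
    intro κ _
    exact card_le_two
  have c6 := card_union_le (RM.image r ∪ SM.image s) 
      (CM.biUnion (fun κ => (w κ).elim ∅ (fun v => ({v.1, v.2} : Finset ℕ))) ∪ 
        JM.biUnion (fun p => ({r p.1, s p.2} : Finset ℕ)))
  have c7 := card_union_le (RM.image r) (SM.image s)
  have c8 := card_union_le 
      (CM.biUnion (fun κ => (w κ).elim ∅ (fun v => ({v.1, v.2} : Finset ℕ)))) 
        (JM.biUnion (fun p => ({r p.1, s p.2} : Finset ℕ)))
  rw [card_range] at c1
  omega

def cls (i j : ℕ) : ℕ × ℕ := if i = j then (0, 0) else (min i j, max i j)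

theorem cls_parity (i j l : ℕ) :
    ((if i = l then 1 else 0) + (if j = l then 1 else 0) : ZMod 2) =
      (if (cls i j).1 = l then 1 else 0) + (if (cls i j).2 = l then 1 else 0) := by
  unfold cls
  by_cases h : i = j
  · subst h
    simp [CharTwo.add_self_eq_zero]
  · rcases lt_or_gt_of_ne h with h' | h'
    · simp [h, min_eq_left h'.le, max_eq_right h'.le]
    · simp [h, min_eq_right h'.le, max_eq_left h'.le, add_comm]

def Hset {n : ℕ} (σ τ : Equiv.Perm (Fin n)) : Finset (Fin n × Fin n) :=
  univ.filter (fun p => p.2 = σ p.1 ∨ p.2 = τ p.1)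

def Eset {n : ℕ} (σ τ : Equiv.Perm (Fin n)) : Finset (Fin n × Fin n) :=
  univ.filter (fun p => ¬ (p.2 = σ p.1 ∨ p.2 = τ p.1))

theorem row_card {n : ℕ} (σ τ : Equiv.Perm (Fin n)) (h : ∀ a, σ a ≠ τ a) (a : Fin n) :
    (univ.filter (fun b => ¬ (b = σ a ∨ b = τ a))).card = n - 2 := by
  have : univ.filter (fun b => ¬ (b = σ a ∨ b = τ a)) = univ \ {σ a, τ a} := by
    ext b; simp
  rw [this, card_sdiff_of_subset (subset_univ _), card_pair (h a)]; simp

theorem col_card {n : ℕ} (σ τ : Equiv.Perm (Fin n)) (h : ∀ a, σ a ≠ τ a) (b : Fin n) :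
    (univ.filter (fun a => ¬ (b = σ a ∨ b = τ a))).card = n - 2 := by
  have : univ.filter (fun a => ¬ (b = σ a ∨ b = τ a)) = univ \ {σ.symm b, τ.symm b} := by
    ext a; simp [Equiv.eq_symm_apply, eq_comm]
  rw [this, card_sdiff_of_subset (subset_univ _), card_pair]
  · simp
  · intro h'
    apply h (σ.symm b)
    conv_rhs => rw [h']
    simp

theorem Eset_card {n : ℕ} (σ τ : Equiv.Perm (Fin n)) (h : ∀ a, σ a ≠ τ a) :
    (Eset σ τ).card = n * (n - 2) := by
  unfold Eset
  rw [card_filter, Fintype.sum_prod_type]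
  simp_rw [← card_filter, row_card σ τ h]
  simp

theorem H_row {n : ℕ} (σ τ : Equiv.Perm (Fin n)) (P : Fin n → Prop) [DecidablePred P] :
    ((Hset σ τ).filter (fun p => P p.1)).card ≤ 2 * (univ.filter P).card := by
  have : (Hset σ τ).filter (fun p => P p.1) ⊆
      (univ.filter P).image (fun a => (a, σ a)) ∪ (univ.filter P).image (fun a => (a, τ a)) := by
    rintro ⟨a, b⟩ h
    simp [Hset] at h
    simp
    rcases h with ⟨h | h, h'⟩
    · left; exact ⟨h', h.symm⟩
    · right; exact ⟨h', h.symm⟩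
  refine (card_le_card this).trans ((card_union_le _ _).trans ?_)
  have h1 := card_image_le (s := univ.filter P) (f := fun a => (a, σ a))
  have h2 := card_image_le (s := univ.filter P) (f := fun a => (a, τ a))
  omega

theorem H_col {n : ℕ} (σ τ : Equiv.Perm (Fin n)) (P : Fin n → Prop) [DecidablePred P] :
    ((Hset σ τ).filter (fun p => P p.2)).card ≤ 2 * (univ.filter P).card := by
  have : (Hset σ τ).filter (fun p => P p.2) ⊆
      (univ.filter P).image (fun b => (σ.symm b, b)) ∪
        (univ.filter P).image (fun b => (τ.symm b, b)) := by
    rintro ⟨a, b⟩ h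
    simp [Hset] at h
    simp
    rcases h with ⟨h | h, h'⟩
    · left; exact ⟨h', by simp [h]⟩
    · right; exact ⟨h', by simp [h]⟩
  refine (card_le_card this).trans ((card_union_le _ _).trans ?_)
  have h1 := card_image_le (s := univ.filter P) (f := fun b => (σ.symm b, b))
  have h2 := card_image_le (s := univ.filter P) (f := fun b => (τ.symm b, b))
  omega

theorem T_card {n : ℕ} (r s : Fin n → ℕ) (i j : ℕ) :
    ((univ : Finset (Fin n × Fin n)).filter (fun p => r p.1 = i ∧ s p.2 = j)).card =
      (univ.filter (fun a => r a = i)).card * (univ.filter (fun a => s a = j)).card := by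
  rw [← card_product]; congr 1; ext ⟨a, b⟩; simp

theorem TT_card {n : ℕ} (r s : Fin n → ℕ) (i j : ℕ) (hij : i < j) :
    ((univ : Finset (Fin n × Fin n)).filter (fun p => cls (r p.1) (s p.2) = (i, j))).card =
      (univ.filter (fun a => r a = i)).card * (univ.filter (fun a => s a = j)).card +
      (univ.filter (fun a => r a = j)).card * (univ.filter (fun a => s a = i)).card := by
  rw [← T_card, ← T_card, ← card_union_of_disjoint]
  · congr 1
    ext ⟨a, b⟩
    simp only [mem_filter, mem_union, mem_univ, true_and]
    unfold cls
    split_ifs with h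
    · simp only [Prod.mk.injEq]; omega
    · simp only [Prod.mk.injEq]; omega
  · rw [disjoint_filter]
    intro p _ h1 h2
    omega

theorem D_card {n : ℕ} (r s : Fin n → ℕ) (k : ℕ) (hr : ∀ a, r a ≤ k) :
    ((univ : Finset (Fin n × Fin n)).filter (fun p => cls (r p.1) (s p.2) = (0, 0))).card =
      ∑ i ∈ range (k + 1), (univ.filter (fun a => r a = i)).card *
        (univ.filter (fun a => s a = i)).card := by
  rw [card_eq_sum_card_fiberwise (f := fun p => r p.1) (t := range (k + 1))]
  · apply sum_congr rfl
    intro i _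
    rw [← T_card, filter_filter]
    congr 1
    ext ⟨a, b⟩
    simp only [mem_filter, mem_univ, true_and]
    unfold cls
    split_ifs with h
    · simp only [true_and]; omega
    · simp only [Prod.mk.injEq]; omega
  · intro p _
    have := hr p.1
    simp; omega

theorem EH_card {n : ℕ} (σ τ : Equiv.Perm (Fin n)) (P : Fin n × Fin n → Prop) [DecidablePred P] :
    ((Eset σ τ).filter P).card + ((Hset σ τ).filter P).card = (univ.filter P).card := by
  rw [← card_union_of_disjoint]
  · congr 1
    ext p
    simp only [Eset, Hset, mem_union, mem_filter, mem_univ, true_and]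
    tauto
  · rw [disjoint_left]
    intro p h1 h2
    simp only [Eset, Hset, mem_filter, mem_univ, true_and] at h1 h2
    tauto

theorem lab_card (n k : ℕ) (x : ℕ → ℕ) (L : ℕ → ℕ) (hX : ∑ i ∈ range k, x i ≤ n)
    (h1 : ∀ a, L a ≤ k) (h2 : ∀ a, L a < k ↔ a < ∑ i ∈ range k, x i)
    (h3 : ∀ i < k, ((range (∑ i ∈ range k, x i)).filter (fun a => L a = i)).card = x i) :
    (∀ i < k, (univ.filter (fun a : Fin n => L a = i)).card = x i) ∧
      (univ.filter (fun a : Fin n => L a = k)).card = n - ∑ i ∈ range k, x i := by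
  have key : ∀ i, (univ.filter (fun a : Fin n => L a = i)).card =
      ((range n).filter (fun a => L a = i)).card := by
    intro i
    rw [card_filter, card_filter]
    exact Fin.sum_univ_eq_sum_range (fun a => if L a = i then 1 else 0) n
  constructor
  · intro i hi
    rw [key, ← h3 i hi]
    congr 1
    ext a
    have := h2 a
    simp only [mem_filter, mem_range]
    omega
  · rw [key]
    have : (range n).filter (fun a => L a = k) = Ico (∑ i ∈ range k, x i) n := by
      ext a
      have := h2 a
      have := h1 a
      simp only [mem_filter, mem_range, mem_Ico]
      omega
    rw [this]; simp

theorem rev_card (n : ℕ) (L : ℕ → ℕ) (i : ℕ) :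
    (univ.filter (fun a : Fin n => L (Fin.rev a) = i)).card =
      (univ.filter (fun a : Fin n => L a = i)).card := by
  rw [card_filter, card_filter]
  exact Equiv.sum_comp (Fin.revPerm (n := n)) (fun a => if L a = i then 1 else 0)

theorem rot_exists (n : ℕ) (hn : 2 ≤ n) : ∃ τ : Equiv.Perm (Fin n),
    (∀ a, a ≠ τ a) ∧ ∀ a : Fin n, (τ a : ℕ) ≤ a + 1 := by
  obtain ⟨m, rfl⟩ : ∃ m, n = m + 2 := ⟨n - 2, by omega⟩
  refine ⟨finRotate (m + 2), ?_, ?_⟩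
  · intro a h
    by_cases ha : a = Fin.last (m + 1)
    · subst ha; simp at h
    · have := coe_finRotate_of_ne_last ha
      rw [← h] at this; omega
  · intro a
    by_cases ha : a = Fin.last (m + 1)
    · subst ha; simp
    · exact (coe_finRotate_of_ne_last ha).le

theorem comb_cells (n k q : ℕ) (hn : 3 ≤ n) (x y : ℕ → ℕ) (f : ℕ × ℕ → ℕ)
    (hXY : ∑ i ∈ range k, x i + ∑ i ∈ range k, y i < n)
    (hf1 : ∀ i j, i < j → j < k → n * f (i, j) ≤ x i * y j + x j * y i)
    (hf2 : ∀ i < k, n * f (i, k) + 2 * x i + 2 * y i ≤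
      x i * (n - ∑ i ∈ range k, y i) + (n - ∑ i ∈ range k, x i) * y i)
    (hf3 : n * f (0, 0) + 2 * n ≤ ∑ i ∈ range k, x i * y i +
      (n - ∑ i ∈ range k, x i) * (n - ∑ i ∈ range k, y i))
    (hf4 : ∀ i j, f (i, j) ≠ 0 → (i = 0 ∧ j = 0) ∨ (i < j ∧ j ≤ k))
    (hf5 : ∀ l < k, ((x l + y l + (∑ j ∈ range (k + 1), f (l, j) +
      ∑ i ∈ range (k + 1), f (i, l)) : ℕ) : ZMod 2) = 1)
    (hq : n - 2 ≤ q + ∑ i ∈ range (k + 1), ∑ j ∈ range (k + 1), f (i, j)) :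
    ∃ (σ τ : Equiv.Perm (Fin n)) (c : Fin n × Fin n → ℕ), (∀ a, σ a ≠ τ a) ∧
      (∀ p ∈ Eset σ τ, c p < n - 2) ∧
      (∀ κ < n - 2, ((Eset σ τ).filter (fun p => c p = κ)).card = n) ∧
      (∀ M ⊆ Eset σ τ, Set.InjOn Prod.fst (M : Set (Fin n × Fin n)) →
        Set.InjOn Prod.snd (M : Set (Fin n × Fin n)) →
        Set.InjOn c (M : Set (Fin n × Fin n)) →
        k + 4 * M.card ≤ 2 * n + 2 * (n - 2) + 2 * q) := by
  obtain ⟨τ, hτ, hτ'⟩ := rot_exists n (by omega)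
  set σ : Equiv.Perm (Fin n) := Equiv.refl _ with hσ
  have hστ : ∀ a, σ a ≠ τ a := hτ
  obtain ⟨Lx, ax1, ax2, ax3⟩ := label_lemma x k
  obtain ⟨Ly, ay1, ay2, ay3⟩ := label_lemma y k
  obtain ⟨bx1, bx2⟩ := lab_card n k x Lx (by omega) ax1 ax2 ax3
  obtain ⟨cby1, cby2⟩ := lab_card n k y Ly (by omega) ay1 ay2 ay3
  set X := ∑ i ∈ range k, x i with hX
  set Y := ∑ i ∈ range k, y i with hY
  set r : Fin n → ℕ := fun a => Lx a with hr
  set s : Fin n → ℕ := fun a => Ly (Fin.rev a) with hs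
  have cr1 : ∀ i < k, (univ.filter (fun a => r a = i)).card = x i := bx1
  have cr2 : (univ.filter (fun a => r a = k)).card = n - X := bx2
  have cs1 : ∀ i < k, (univ.filter (fun a => s a = i)).card = y i := by
    intro i hi; rw [← cby1 i hi]; exact rev_card n Ly i
  have cs2 : (univ.filter (fun a => s a = k)).card = n - Y := by
    rw [← cby2]; exact rev_card n Ly k
  have hrk : ∀ a, r a ≤ k := fun a => ax1 _
  have hsk : ∀ a, s a ≤ k := fun a => ay1 _
  set lab : Fin n × Fin n → ℕ × ℕ := fun p => cls (r p.1) (s p.2) with hlab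
  obtain ⟨c, w, h1, h2, h3, h4⟩ := color_lemma n (by omega) lab (n - 2) (Eset σ τ) f
    (Eset_card σ τ hστ) (by
      rintro ⟨i, j⟩
      by_cases hz : f (i, j) = 0
      · simp [hz]
      rcases hf4 i j hz with ⟨rfl, rfl⟩ | ⟨hij, hjk⟩
      · have e1 := EH_card σ τ (fun p => lab p = (0, 0))
        have e2 : (univ.filter (fun p => lab p = (0, 0))).card = _ := D_card r s k hrk
        rw [sum_range_succ, cr2, cs2] at e2
        have e3 : ∑ i ∈ range k, (univ.filter (fun a => r a = i)).card *
            (univ.filter (fun a => s a = i)).card = ∑ i ∈ range k, x i * y i := by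
          apply sum_congr rfl
          intro i hi
          rw [cr1 i (mem_range.1 hi), cs1 i (mem_range.1 hi)]
        rw [e3] at e2
        have e4 : ((Hset σ τ).filter (fun p => lab p = (0, 0))).card ≤ 2 * n := by
          have := H_row σ τ (fun _ => True)
          simp at this
          exact (card_filter_le _ _).trans this
        omega
      · have e1 := EH_card σ τ (fun p => lab p = (i, j))
        have e2 : (univ.filter (fun p => lab p = (i, j))).card = _ := TT_card r s i j hij
        rcases Nat.lt_or_ge j k with hjk' | hjk'
        · rw [cr1 i (by omega), cr1 j hjk', cs1 i (by omega), cs1 j hjk'] at e2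
          have e4 : (Hset σ τ).filter (fun p => lab p = (i, j)) = ∅ := by
            rw [filter_eq_empty_iff]
            rintro ⟨a, b⟩ hab hl
            have ha : r a < k ∧ s b < k := by
              simp only [hlab, cls] at hl
              split_ifs at hl
              · simp only [Prod.mk.injEq] at hl; omega
              · simp only [Prod.mk.injEq] at hl; omega
            have i1 := (ax2 _).1 ha.1
            have i2 := (ay2 _).1 ha.2
            have i3 := Fin.val_rev b
            have i4 := hτ' a
            have i5 := b.2
            simp only [Hset, mem_filter, mem_univ, true_and, hσ, Equiv.refl_apply] at hab
            have i6 : (b : ℕ) ≤ a + 1 := by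
              rcases hab with h | h
              · rw [h]; omega
              · rw [h]; omega
            omega
          rw [e4, card_empty] at e1
          have := hf1 i j hij hjk'
          omega
        · have hj : j = k := by omega
          subst hj
          rw [cr1 i hij, cr2, cs1 i hij, cs2] at e2
          have e4 : (Hset σ τ).filter (fun p => lab p = (i, j)) ⊆
              (Hset σ τ).filter (fun p => r p.1 = i) ∪ (Hset σ τ).filter (fun p => s p.2 = i) := by
            intro p hp
            rw [mem_filter] at hp
            have hl := hp.2
            have : r p.1 = i ∨ s p.2 = i := by
              simp only [hlab, cls] at hl
              split_ifs at hl
              · simp only [Prod.mk.injEq] at hl; omega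
              · simp only [Prod.mk.injEq] at hl; omega
            rw [mem_union, mem_filter, mem_filter]
            tauto
          have e5 := (card_le_card e4).trans (card_union_le _ _)
          have e6 := H_row σ τ (fun a => r a = i)
          have e7 := H_col σ τ (fun a => s a = i)
          rw [cr1 i hij] at e6
          rw [cs1 i hij] at e7
          have := hf2 i hij
          omega)
  have hwS : ∀ κ ∈ range (n - 2), ∀ v, w κ = some v → v ∈ range (k + 1) ×ˢ range (k + 1) := by
    intro κ hκ v hv
    have hpos : f v ≠ 0 := by
      rw [← h4 v]
      exact (card_pos.2 ⟨κ, mem_filter.2 ⟨hκ, hv⟩⟩).ne'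
    have := hf4 v.1 v.2 hpos
    simp only [mem_product, mem_range]
    omega
  refine ⟨σ, τ, c, hστ, h1, h2, ?_⟩
  intro M hM hM1 hM2 hM3
  -- sum over colours, regrouped by label
  have regroup : ∀ {R : Type} [CommSemiring R] (g : ℕ × ℕ → R),
      ∑ κ ∈ range (n - 2), ((w κ).elim 0 g) =
        ∑ v ∈ range (k + 1) ×ˢ range (k + 1), (f v : R) * g v := by
    intro R _ g
    have : ∀ κ ∈ range (n - 2), (w κ).elim 0 g =
        ∑ v ∈ range (k + 1) ×ˢ range (k + 1), if w κ = some v then g v else 0 := by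
      intro κ hκ
      rcases hwk : w κ with _ | v
      · simp
      · have := hwS κ hκ v hwk
        simp only [Option.elim, Option.some.injEq]
        rw [sum_ite_eq, if_pos this]
    rw [sum_congr rfl this, sum_comm]
    apply sum_congr rfl
    intro v _
    rw [← h4 v, ← sum_filter, sum_const, nsmul_eq_mul]
  refine match_lemma n (n - 2) k q r s c w M (fun p hp => h1 p (hM hp)) ?_ hM1 hM2 hM3 ?_ ?_
  · intro p hp v hv l
    rw [← h3 p (hM hp) v hv]
    exact cls_parity _ _ _
  · have hh := regroup (R := ℕ) (fun _ => 1)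
    rw [sum_product] at hh
    simp only [mul_one, Nat.cast_id] at hh
    have hh2 : ∑ κ ∈ range (n - 2), ((w κ).elim 0 (fun _ => 1)) +
        ((range (n - 2)).filter (fun κ => w κ = none)).card = n - 2 := by
      rw [card_filter, ← sum_add_distrib]
      rw [sum_congr rfl (g := fun _ => 1)]
      · simp
      · intro κ _
        rcases w κ with _ | v <;> simp
    omega
  · intro l hl
    rw [regroup]
    have e1 : (∑ a, (if r a = l then 1 else 0) : ZMod 2) = x l := by
      rw [sum_boole, cr1 l hl]
    have e2 : (∑ a, (if s a = l then 1 else 0) : ZMod 2) = y l := by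
      rw [sum_boole, cs1 l hl]
    have hlk : l ∈ range (k + 1) := by simp; omega
    rw [e1, e2]
    refine Eq.trans ?_ (hf5 l hl)
    push_cast
    congr 1
    simp only [mul_add, sum_add_distrib]
    congr 1
    · rw [sum_product]
      simp only [mul_ite, mul_one, mul_zero]
      rw [sum_comm]
      apply sum_congr rfl
      intro j _
      rw [sum_ite_eq', if_pos hlk]
    · rw [sum_product]
      simp only [mul_ite, mul_one, mul_zero]
      apply sum_congr rfl
      intro i _
      rw [sum_ite_eq', if_pos hlk]

theorem comb_graph (n : ℕ) (hn : 3 ≤ n) (B : ℕ) (σ τ : Equiv.Perm (Fin n))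
    (c : Fin n × Fin n → ℕ) (hστ : ∀ a, σ a ≠ τ a)
    (h1 : ∀ p ∈ Eset σ τ, c p < n - 2)
    (h2 : ∀ κ < n - 2, ((Eset σ τ).filter (fun p => c p = κ)).card = n)
    (h3 : ∀ M ⊆ Eset σ τ, Set.InjOn Prod.fst (M : Set (Fin n × Fin n)) →
        Set.InjOn Prod.snd (M : Set (Fin n × Fin n)) →
        Set.InjOn c (M : Set (Fin n × Fin n)) → M.card ≤ B) :
    ∃ (G : SimpleGraph (Fin n ⊕ Fin n)) (c : Sym2 (Fin n ⊕ Fin n) → Fin (n - 2)),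
        (∀ u v : Fin n ⊕ Fin n, G.Adj u v →
          (u.isLeft ∧ v.isRight) ∨ (u.isRight ∧ v.isLeft)) ∧
        (∀ (v : Fin n ⊕ Fin n) [Fintype (G.neighborSet v)], G.degree v = n - 2) ∧
        (∀ k : Fin (n - 2), {e : Sym2 (Fin n ⊕ Fin n) | e ∈ G.edgeSet ∧ c e = k}.ncard = n) ∧
        (∀ M : Finset (Sym2 (Fin n ⊕ Fin n)),
          (∀ e ∈ M, e ∈ G.edgeSet) →
          (∀ e ∈ M, ∀ f ∈ M, e ≠ f → ∀ v : Fin n ⊕ Fin n, v ∈ e → v ∉ f) →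
          (∀ e ∈ M, ∀ f ∈ M, e ≠ f → c e ≠ c f) → M.card ≤ B) := by
  classical
  let G : SimpleGraph (Fin n ⊕ Fin n) :=
    { Adj := fun u v => ∃ p ∈ Eset σ τ, (u = Sum.inl p.1 ∧ v = Sum.inr p.2) ∨
        (v = Sum.inl p.1 ∧ u = Sum.inr p.2)
      symm := ⟨by rintro u v ⟨p, hp, h⟩; exact ⟨p, hp, h.symm⟩⟩
      loopless := ⟨by rintro u ⟨p, hp, ⟨rfl, h⟩ | ⟨rfl, h⟩⟩ <;> simp at h⟩ }
  have hadj : ∀ a b, G.Adj (Sum.inl a) (Sum.inr b) ↔ (a, b) ∈ Eset σ τ := by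
    intro a b
    constructor
    · rintro ⟨⟨a', b'⟩, hp, h⟩
      simp at h
      rw [h.1, h.2]; exact hp
    · intro h; exact ⟨(a, b), h, by simp⟩
  let φ : Fin n × Fin n → Sym2 (Fin n ⊕ Fin n) := fun p => s(Sum.inl p.1, Sum.inr p.2)
  have hφ : Function.Injective φ := by
    rintro ⟨a, b⟩ ⟨a', b'⟩ h
    simpa [φ] using h
  have hφE : ∀ p, φ p ∈ G.edgeSet ↔ p ∈ Eset σ τ := by
    rintro ⟨a, b⟩
    rw [← hadj]; rfl
  have hEφ : ∀ e ∈ G.edgeSet, ∃ p, φ p = e := by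
    intro e
    induction e with | _ u v =>
    rintro ⟨p, hp, ⟨rfl, rfl⟩ | ⟨rfl, rfl⟩⟩
    · exact ⟨p, rfl⟩
    · exact ⟨p, Sym2.eq_swap⟩
  let c0 : Fin n × Fin n → Fin (n - 2) := fun p =>
    if h : c p < n - 2 then ⟨c p, h⟩ else ⟨0, by omega⟩
  have hc0 : ∀ p ∈ Eset σ τ, (c0 p : ℕ) = c p := by
    intro p hp; simp [c0, h1 p hp]
  let c1 : Sym2 (Fin n ⊕ Fin n) → Fin (n - 2) := Function.extend φ c0 (fun _ => ⟨0, by omega⟩)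
  have hc1 : ∀ p, c1 (φ p) = c0 p := fun p => hφ.extend_apply _ _ _
  refine ⟨G, c1, ?_, ?_, ?_, ?_⟩
  · rintro u v ⟨p, hp, ⟨rfl, rfl⟩ | ⟨rfl, rfl⟩⟩ <;> simp
  · intro v _
    rw [← SimpleGraph.card_neighborFinset_eq_degree]
    rcases v with a | b
    · rw [← row_card σ τ hστ a, ← card_map (⟨Sum.inr, Sum.inr_injective⟩ : Fin n ↪ Fin n ⊕ Fin n)]
      congr 1
      ext u
      rw [SimpleGraph.mem_neighborFinset]
      rcases u with a' | b'
      · simp [G]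
      · rw [hadj]; simp [Eset]
    · rw [← col_card σ τ hστ b, ← card_map (⟨Sum.inl, Sum.inl_injective⟩ : Fin n ↪ Fin n ⊕ Fin n)]
      congr 1
      ext u
      rw [SimpleGraph.mem_neighborFinset]
      rcases u with a' | b'
      · rw [SimpleGraph.adj_comm, hadj]; simp [Eset]
      · simp [G]
  · intro κ
    have : {e : Sym2 (Fin n ⊕ Fin n) | e ∈ G.edgeSet ∧ c1 e = κ} =
        (((Eset σ τ).filter (fun p => c p = κ)).image φ : Finset _) := by
      ext e
      simp only [Set.mem_ofPred_eq, coe_image, coe_filter, Set.mem_image]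
      constructor
      · rintro ⟨he, hk⟩
        obtain ⟨p, rfl⟩ := hEφ e he
        have hp := (hφE p).1 he
        refine ⟨p, ⟨hp, ?_⟩, rfl⟩
        rw [← hc0 p hp, ← hc1, hk]
      · rintro ⟨p, ⟨hp, hk⟩, rfl⟩
        refine ⟨(hφE p).2 hp, ?_⟩
        rw [hc1]
        apply Fin.ext
        rw [hc0 p hp, hk]
    rw [this, Set.ncard_coe_finset, card_image_of_injective _ hφ, h2 κ κ.2]
  · intro M hM1 hM2 hM3
    set M' : Finset (Fin n × Fin n) := univ.filter (fun p => φ p ∈ M) with hM'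
    have hmem : ∀ p, p ∈ M' ↔ φ p ∈ M := by intro p; simp [hM']
    have hcard : M = M'.image φ := by
      ext e
      rw [mem_image]
      constructor
      · intro he
        obtain ⟨p, rfl⟩ := hEφ e (hM1 e he)
        exact ⟨p, (hmem p).2 he, rfl⟩
      · rintro ⟨p, hp, rfl⟩
        exact (hmem p).1 hp
    rw [hcard, card_image_of_injective _ hφ]
    have hsub : M' ⊆ Eset σ τ := fun p hp => (hφE p).1 (hM1 _ ((hmem p).1 hp))
    apply h3 M' hsub
    · intro p hp p' hp' h
      by_contra hne
      refine hM2 _ ((hmem p).1 hp) _ ((hmem p').1 hp') (fun h => hne (hφ h)) (Sum.inl p.1) ?_ ?_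
      · simp [φ]
      · simp [φ, h]
    · intro p hp p' hp' h
      by_contra hne
      refine hM2 _ ((hmem p).1 hp) _ ((hmem p').1 hp') (fun h => hne (hφ h)) (Sum.inr p.2) ?_ ?_
      · simp [φ]
      · simp [φ, h]
    · intro p hp p' hp' h
      by_contra hne
      refine hM3 _ ((hmem p).1 hp) _ ((hmem p').1 hp') (fun h => hne (hφ h)) ?_
      rw [hc1, hc1]
      apply Fin.ext
      rw [hc0 p (hsub hp), hc0 p' (hsub hp'), h]

def u (n : ℕ) : ℕ := ∑ j ∈ range n, 16 ^ j

theorem u_succ (n : ℕ) : u (n + 1) = u n + 16 ^ n := sum_range_succ _ _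

theorem u_eq (n : ℕ) : 15 * u n + 1 = 16 ^ n := by
  induction n with
  | zero => simp [u]
  | succ n ih => rw [u_succ, pow_succ]; omega

def ff (K f00 : ℕ) (F : ℕ → ℕ) (v : ℕ × ℕ) : ℕ :=
  (if v.1 = 0 ∧ v.2 = 0 then f00 else 0) +
  ((if v.1 < v.2 ∧ v.2 ≤ K then 7 * 16 ^ (v.2 - 1 - v.1) else 0) +
  (if v.1 ≤ K ∧ v.2 = K + 1 then F v.1 else 0))

theorem sum1 (l d : ℕ) : ∑ j ∈ range (l + d + 1), (if l < j then 7 * 16 ^ (j - 1 - l) else 0) =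
    7 * u d := by
  induction d with
  | zero =>
    rw [sum_eq_zero]
    · simp [u]
    · intro j hj; simp at hj; rw [if_neg]; omega
  | succ d ih =>
    rw [show l + (d + 1) + 1 = (l + d + 1) + 1 by ring, sum_range_succ, ih, u_succ, if_pos (by omega),
      show l + d + 1 - 1 - l = d by omega]
    ring

theorem sum2 (l e : ℕ) : ∑ i ∈ range (l + e), (if i < l then 7 * 16 ^ (l - 1 - i) else 0) =
    7 * u l := by
  induction e with
  | zero =>
    rw [u, mul_sum, ← sum_range_reflect (fun j => 7 * 16 ^ j)]
    apply sum_congr rfl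
    intro i hi; rw [if_pos]; exact mem_range.1 hi
  | succ e ih => rw [← add_assoc, sum_range_succ, ih, if_neg (by omega)]; rfl

theorem row_sum (K f00 : ℕ) (F : ℕ → ℕ) (l : ℕ) (hl : l ≤ K) :
    ∑ j ∈ range (K + 1 + 1), ff K f00 F (l, j) =
      (if l = 0 then f00 else 0) + (7 * u (K - l) + F l) := by
  unfold ff
  rw [sum_add_distrib, sum_add_distrib]
  congr 1
  · rw [sum_eq_single 0]
    · simp
    · intro j _ hj; simp [hj]
    · simp
  · congr 1
    · rw [sum_range_succ, if_neg (by simp), add_zero, ← sum1 l (K - l)]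
      rw [show l + (K - l) + 1 = K + 1 by omega]
      apply sum_congr rfl
      intro j hj
      simp at hj
      have : j ≤ K := by omega
      simp [this]
    · rw [sum_eq_single (K + 1)]
      · simp [hl]
      · intro j _ hj; simp [hj]
      · simp

theorem row_sum_last (K f00 : ℕ) (F : ℕ → ℕ) :
    ∑ j ∈ range (K + 1 + 1), ff K f00 F (K + 1, j) = 0 := by
  apply sum_eq_zero
  intro j hj
  simp [ff]; omega

theorem col_sum (K f00 : ℕ) (F : ℕ → ℕ) (l : ℕ) (hl : l ≤ K) :
    ∑ i ∈ range (K + 1 + 1), ff K f00 F (i, l) =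
      (if l = 0 then f00 else 0) + 7 * u l := by
  unfold ff
  rw [sum_add_distrib, sum_add_distrib]
  congr 1
  · rw [sum_eq_single 0]
    · simp
    · intro j _ hj; simp [hj]
    · simp
  · rw [← sum2 l (K + 2 - l), show l + (K + 2 - l) = K + 1 + 1 by omega]
    rw [sum_eq_zero (s := range (K + 1 + 1)) (f := fun x => if (x, l).1 ≤ K ∧ (x, l).2 = K + 1 then F (x, l).1 else 0), add_zero]
    · apply sum_congr rfl
      intro j hj
      simp [hl]
    · intro i _; simp; omega

theorem aux2 (n T b s t V F ui uk : ℕ) (hb2 : 4096 * T * b ≤ 7 * n + 4096 * T)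
    (hTT : T * 16 ≤ T * T) (hnT : 65536 * (T * T) ≤ n) (hVT : 15 * V + 1 = 16 * T)
    (e1 : F + 1 + 7 * ui + 7 * uk = 256 * s + b * t) (e2 : 15 * ui + 1 = s) (e3 : 15 * uk + 1 = t)
    (es : s ≤ T) (et : t ≤ T) (hX : 256 * V ≤ n) (hY : b * V ≤ n) :
    n * F + 2 * (256 * s) + 2 * (b * t) ≤ 256 * s * (n - b * V) + (n - 256 * V) * (b * t) := by
  have m1 : (4096 * T * b) * (s + t) ≤ (7 * n + 4096 * T) * (s + t) := Nat.mul_le_mul_right _ hb2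
  have m2 : T * (s + t) ≤ T * (2 * T) := Nat.mul_le_mul_left _ (by omega)
  have m3 : 0 ≤ b * s := Nat.zero_le _
  have m4 : 0 ≤ b * t := Nat.zero_le _
  zify [hX, hY] at *
  have key : (256 * (b:ℤ) * (16 * T - 1)) * (s + t) + 30 * (256 * s + b * t) ≤
      n * (1 + 7 * (s + t)) := by
    linarith
  have hF' : (F : ℤ) = 256 * s + b * t - 1 - 7 * ui - 7 * uk := by linarith
  have hV' : 16 * T - 1 = 15 * (V:ℤ) := by linarith
  rw [hV'] at key
  rw [hF']
  have key2 : n * (1 + 7 * ((s:ℤ) + t)) = 15 * (n * (1 + 7 * ui + 7 * uk)) := by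
    rw [← e2, ← e3]; ring
  rw [key2] at key
  linarith

set_option maxHeartbeats 1000000 in
theorem numbers (n K : ℕ) (hK : 1 ≤ K) (hn : 16 ^ (2 * K + 4) ≤ n) :
    ∃ (x y : ℕ → ℕ) (f : ℕ × ℕ → ℕ) (q : ℕ),
    (∑ i ∈ range (K + 1), x i + ∑ i ∈ range (K + 1), y i < n) ∧
    (∀ i j, i < j → j < K + 1 → n * f (i, j) ≤ x i * y j + x j * y i) ∧
    (∀ i < K + 1, n * f (i, K + 1) + 2 * x i + 2 * y i ≤
      x i * (n - ∑ i ∈ range (K + 1), y i) + (n - ∑ i ∈ range (K + 1), x i) * y i) ∧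
    (n * f (0, 0) + 2 * n ≤ ∑ i ∈ range (K + 1), x i * y i +
      (n - ∑ i ∈ range (K + 1), x i) * (n - ∑ i ∈ range (K + 1), y i)) ∧
    (∀ i j, f (i, j) ≠ 0 → (i = 0 ∧ j = 0) ∨ (i < j ∧ j ≤ K + 1)) ∧
    (∀ l < K + 1, ((x l + y l + (∑ j ∈ range (K + 1 + 1), f (l, j) +
      ∑ i ∈ range (K + 1 + 1), f (i, l)) : ℕ) : ZMod 2) = 1) ∧
    (n - 2 ≤ q + ∑ i ∈ range (K + 1 + 1), ∑ j ∈ range (K + 1 + 1), f (i, j)) ∧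
    8 * q ≤ 7 + (K + 1) := by
  obtain ⟨T, hT⟩ : ∃ T, T = 16 ^ K := ⟨_, rfl⟩
  have hT1 : 16 ≤ T := by
    rw [hT]; calc 16 = 16 ^ 1 := by norm_num
      _ ≤ 16 ^ K := Nat.pow_le_pow_right (by norm_num) hK
  have hnT : 65536 * (T * T) ≤ n := by
    refine le_trans (le_of_eq ?_) hn
    rw [hT]; ring
  have hTT : T * 16 ≤ T * T := Nat.mul_le_mul_left _ hT1
  obtain ⟨b, hb⟩ : ∃ b, b = 7 * n / (4096 * T) + 1 := ⟨_, rfl⟩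
  have hb1 : 7 * n ≤ 4096 * T * b := by
    rw [hb]; exact (Nat.lt_mul_div_succ _ (by positivity)).le
  have hb2 : 4096 * T * b ≤ 7 * n + 4096 * T := by
    rw [hb, mul_add, mul_one]
    have := Nat.mul_div_le (7 * n) (4096 * T)
    omega
  have hb0 : 1 ≤ b := by rw [hb]; exact Nat.le_add_left _ _
  set x : ℕ → ℕ := fun i => 256 * 16 ^ i with hx
  set y : ℕ → ℕ := fun i => b * 16 ^ (K - i) with hy
  obtain ⟨V, hV⟩ : ∃ V, V = u (K + 1) := ⟨_, rfl⟩
  have hVT : 15 * V + 1 = 16 * T := by rw [hV, u_eq, hT]; ring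
  have hX : ∑ i ∈ range (K + 1), x i = 256 * V := by
    rw [hV, u, mul_sum]
  have hY : ∑ i ∈ range (K + 1), y i = b * V := by
    rw [hV, u, mul_sum, ← sum_range_reflect]
    apply sum_congr rfl
    intro i hi
    simp at hi
    simp only [hy]
    congr 2
    omega
  have hxy : ∀ i < K + 1, x i * y i = 256 * b * T := by
    intro i hi
    simp only [hx, hy, hT]
    have : 16 ^ K = 16 ^ i * 16 ^ (K - i) := by rw [← pow_add]; congr 1; omega
    rw [this]; ring
  have hsxy : ∑ i ∈ range (K + 1), x i * y i = (K + 1) * (256 * b * T) := by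
    rw [sum_congr rfl (fun i hi => hxy i (mem_range.1 hi))]; simp
  set F : ℕ → ℕ := fun i => x i + y i - 1 - 7 * u i - 7 * u (K - i) with hF
  have hFe : ∀ i, F i + 1 + 7 * u i + 7 * u (K - i) = x i + y i := by
    intro i
    have e1 := u_eq i
    have e2 := u_eq (K - i)
    have e3 : 1 * 16 ^ (K - i) ≤ b * 16 ^ (K - i) := Nat.mul_le_mul_right _ hb0
    simp only [hF, hx, hy]
    omega
  -- size facts
  have hbV : 15 * (b * V) + b = 16 * (T * b) := by nlinarith
  have hTb : 4096 * (T * b) ≤ 7 * n + 4096 * T := by nlinarith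
  have hX4 : 4 * (256 * V) ≤ n := by omega
  have hY4 : 4 * (b * V) ≤ n := by omega
  set Z := (K + 1) * (256 * b * T) + (n - 256 * V) * (n - b * V) with hZ
  have hnpos : 16 ≤ n := by omega
  have hZ2 : 2 * n ≤ Z := by
    have h1 : 2 ≤ n - 256 * V := by omega
    have h3 : 4 ≤ n - 256 * V := by omega
    have h2 : n ≤ 2 * (n - b * V) := by omega
    have h4 : 4 * (n - b * V) ≤ (n - 256 * V) * (n - b * V) := Nat.mul_le_mul_right _ h3
    omega
  obtain ⟨f00, hf00⟩ : ∃ f00, f00 = (Z - 2 * n) / n := ⟨_, rfl⟩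
  have hf1 : n * f00 + 2 * n ≤ Z := by
    have := Nat.mul_div_le (Z - 2 * n) n
    rw [hf00]; omega
  have hf2 : Z < n * f00 + 3 * n := by
    have := Nat.lt_mul_div_succ (Z - 2 * n) (show 0 < n by omega)
    rw [hf00]
    rw [mul_add] at this
    omega
  -- total sum
  obtain ⟨U, hU⟩ : ∃ U, U = ∑ l ∈ range (K + 1), u l := ⟨_, rfl⟩
  have hUV : 15 * U + (K + 1) = V := by
    rw [hU, hV, mul_sum]
    have : ∑ l ∈ range (K + 1), (15 * u l + 1) = u (K + 1) := by
      simp_rw [u_eq]; rfl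
    rw [← this, sum_add_distrib]; simp
  have hUr : ∑ l ∈ range (K + 1), u (K - l) = U := by
    rw [hU, ← sum_range_reflect (fun l => u l)]
    apply sum_congr rfl
    intro i hi
    congr 1
  have hFsum : ∑ i ∈ range (K + 1), F i + (K + 1) + 7 * U + 7 * U = 256 * V + b * V := by
    rw [← hX, ← hY, ← sum_add_distrib, ← sum_congr rfl (fun i _ => hFe i)]
    rw [sum_add_distrib, sum_add_distrib, sum_add_distrib, ← mul_sum, ← mul_sum, hUr, ← hU]
    simp
  have htot : ∑ i ∈ range (K + 1 + 1), ∑ j ∈ range (K + 1 + 1), ff K f00 F (i, j) =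
      f00 + 7 * U + ∑ i ∈ range (K + 1), F i := by
    rw [sum_range_succ, row_sum_last, add_zero]
    rw [sum_congr rfl (fun i hi => row_sum K f00 F i (Nat.lt_succ_iff.1 (mem_range.1 hi)))]
    rw [sum_add_distrib, sum_add_distrib, ← mul_sum, hUr, sum_ite_eq' ]
    simp; ring
  refine ⟨x, y, ff K f00 F, n - 2 - (f00 + 7 * U + ∑ i ∈ range (K + 1), F i), ?_, ?_, ?_, ?_, ?_, ?_, ?_, ?_⟩
  · rw [hX, hY]; omega
  · intro i j hij hj
    have e0 : ff K f00 F (i, j) = 7 * 16 ^ (j - 1 - i) := by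
      simp only [ff]
      rw [if_neg (by omega), if_pos (by omega), if_neg (by omega)]; ring
    have e1 : x j * y i = 16 ^ (j - 1 - i) * (4096 * T * b) := by
      simp only [hx, hy, hT]
      have h1 : 16 ^ j * 16 ^ (K - i) = 16 ^ (j - 1 - i) * 16 ^ (K + 1) := by
        rw [← pow_add, ← pow_add]; congr 1; omega
      calc 256 * 16 ^ j * (b * 16 ^ (K - i)) = 256 * b * (16 ^ j * 16 ^ (K - i)) := by ring
        _ = _ := by rw [h1, pow_succ]; ring
    rw [e0, e1]
    have := Nat.mul_le_mul_left (16 ^ (j - 1 - i)) hb1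
    calc n * (7 * 16 ^ (j - 1 - i)) = 16 ^ (j - 1 - i) * (7 * n) := by ring
      _ ≤ _ := this
      _ ≤ _ := Nat.le_add_left _ _
  · intro i hi
    have e0 : ff K f00 F (i, K + 1) = F i := by
      have hiK : i ≤ K := by omega
      simp [ff, hiK]
    rw [e0, hX, hY]
    have e1 := hFe i
    have e2 := u_eq i
    have e3 := u_eq (K - i)
    obtain ⟨s, hs⟩ : ∃ s, s = 16 ^ i := ⟨_, rfl⟩
    obtain ⟨t, ht⟩ : ∃ t, t = 16 ^ (K - i) := ⟨_, rfl⟩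
    have es : s ≤ T := by rw [hs, hT]; exact Nat.pow_le_pow_right (by norm_num) (by omega)
    have et : t ≤ T := by rw [ht, hT]; exact Nat.pow_le_pow_right (by norm_num) (by omega)
    have exi : x i = 256 * s := by rw [hs]
    have eyi : y i = b * t := by rw [ht]
    rw [← hs] at e2
    rw [← ht] at e3
    rw [exi, eyi] at e1 ⊢
    exact aux2 n T b s t V (F i) (u i) (u (K - i)) hb2 hTT hnT hVT e1 e2 e3 es et
      (by omega) (by omega)
  · have e0 : ff K f00 F (0, 0) = f00 := by simp [ff]
    rw [e0, hX, hY, hsxy]; exact hf1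
  · intro i j h
    simp only [ff] at h
    by_contra hcon
    apply h
    rw [if_neg (by omega), if_neg (by omega), if_neg (by omega)]
  · intro l hl
    rw [row_sum K f00 F l (by omega), col_sum K f00 F l (by omega)]
    have e1 := hFe l
    set g := if l = 0 then f00 else 0
    have : x l + y l + (g + (7 * u (K - l) + F l) + (g + 7 * u l)) =
        2 * (x l + y l + g - 1) + 1 := by omega
    rw [this]
    push_cast
    rw [show (2 : ZMod 2) = 0 from rfl]; ring
  · rw [htot]; omega
  · have hkT : V ≤ (K + 1) * T := by
      have : 2 * T ≤ (K + 1) * T := Nat.mul_le_mul_right _ (by omega)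
      omega
    have hcross : (K + 1) * T + 16 * (T * U) ≤ V * V := by
      have : 15 * ((K + 1) * T + 16 * (T * U)) + (K + 1) * T= 15 * (V * V) + V := by
        have h1 : 16 * T * V = (15 * V + 1) * V := by rw [hVT]
        have h2 : T * (15 * U + (K + 1)) = T * V := by rw [hUV]
        nlinarith
      omega
    have hcross2 : (K + 1) * (256 * b * T) + 7 * n * U ≤ (256 * V) * (b * V) := by
      have h1 := Nat.mul_le_mul_left (256 * b) hcross
      have h2 := Nat.mul_le_mul_right U hb1
      nlinarith
    have hP : 7 * n * (K + 1) ≤ 16 * ((K + 1) * (256 * b * T)) := by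
      have := Nat.mul_le_mul_right (K + 1) hb1
      nlinarith
    have hZ' : (Z : ℤ) = (K + 1) * (256 * b * T) + (n - 256 * V) * (n - b * V) := by
      rw [hZ]
      push_cast [show 256 * V ≤ n by omega, show b * V ≤ n by omega]
      ring
    obtain ⟨Q, hQ⟩ : ∃ Q : ℤ, Q = n - 2 - (f00 + 7 * U + ∑ i ∈ range (K + 1), (F i : ℤ)) := ⟨_, rfl⟩
    have hQn : 8 * Q < 8 + (K + 1) := by
      have hFs : (∑ i ∈ range (K + 1), (F i : ℤ)) = 256 * V + b * V - (K + 1) - 14 * U := by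
        have : ((∑ i ∈ range (K + 1), F i + (K + 1) + 7 * U + 7 * U : ℕ) : ℤ) = ((256 * V + b * V : ℕ) : ℤ) := by
          rw [hFsum]
        push_cast at this
        linarith
      rw [hFs] at hQ
      zify at hf2 hcross2 hP
      rw [hZ'] at hf2
      have hnp : (0:ℤ) < n := by exact_mod_cast (by omega : 0 < n)
      have : n * (8 * Q) < n * (8 + (K + 1)) := by
        rw [hQ]
        linarith
      exact lt_of_mul_lt_mul_left this hnp.le
    have : ((n - 2 - (f00 + 7 * U + ∑ i ∈ range (K + 1), F i) : ℕ) : ℤ) ≤ max Q 0 := by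
      rw [hQ]
      have : (∑ i ∈ range (K + 1), (F i : ℤ)) = ((∑ i ∈ range (K + 1), F i : ℕ) : ℤ) := by push_cast; rfl
      rw [this]
      omega
    omega

theorem log_bound (n K : ℕ) (hn : 1 ≤ n) (h : n < 16 ^ (2 * K + 6)) :
    Real.log n / 42 < (3 * (K + 1) + 9 : ℝ) / 16 := by
  have h1 : Real.log n ≤ (2 * K + 6) * Real.log 16 := by
    have : Real.log n ≤ Real.log ((16:ℝ) ^ (2 * K + 6)) := by
      apply Real.log_le_log
      · exact_mod_cast hn
      · exact_mod_cast h.le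
    rw [Real.log_pow] at this
    push_cast at this
    exact this
  have h2 : Real.log 16 < 2.8 := by
    rw [show (16:ℝ) = 2 ^ 4 by norm_num, Real.log_pow]
    have := Real.log_two_lt_d9
    push_cast
    linarith
  have hK : (0:ℝ) ≤ K := Nat.cast_nonneg K
  nlinarith

end ABW


open scoped Classical in
/-- For all sufficiently large `n`, there exists a bipartite graph `G` with both
parts of size `n` (vertex set `Fin n ⊕ Fin n`, all edges between the parts) which is
`(n-2)`-regular, together with an edge-colouring of `G` using `n - 2` colours in which every
colour is used on exactly `n` edges (so each colour is used on more than `Δ(G) + 1` edges),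
such that `G` has no rainbow matching of size at least `n - (1/42)·ln n`; in particular, `G` has
no rainbow matching using every colour. -/
theorem aharoni_barat_wanless_conjecture_false :
    ∃ N : ℕ, ∀ n : ℕ, N ≤ n →
      ∃ (G : SimpleGraph (Fin n ⊕ Fin n)) (c : Sym2 (Fin n ⊕ Fin n) → Fin (n - 2)),
        (∀ u v : Fin n ⊕ Fin n, G.Adj u v →
          (u.isLeft ∧ v.isRight) ∨ (u.isRight ∧ v.isLeft)) ∧
        (∀ v : Fin n ⊕ Fin n, G.degree v = n - 2) ∧
        (∀ k : Fin (n - 2), {e : Sym2 (Fin n ⊕ Fin n) | e ∈ G.edgeSet ∧ c e = k}.ncard = n) ∧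
        (G.maxDegree + 1 < n) ∧
        (¬ ∃ M : Finset (Sym2 (Fin n ⊕ Fin n)),
          (∀ e ∈ M, e ∈ G.edgeSet) ∧
          (∀ e ∈ M, ∀ f ∈ M, e ≠ f → ∀ v : Fin n ⊕ Fin n, v ∈ e → v ∉ f) ∧
          (∀ e ∈ M, ∀ f ∈ M, e ≠ f → c e ≠ c f) ∧
          (n : ℝ) - Real.log n / 42 ≤ (M.card : ℝ)) ∧
        (¬ ∃ M : Finset (Sym2 (Fin n ⊕ Fin n)),
          (∀ e ∈ M, e ∈ G.edgeSet) ∧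
          (∀ e ∈ M, ∀ f ∈ M, e ≠ f → ∀ v : Fin n ⊕ Fin n, v ∈ e → v ∉ f) ∧
          (∀ e ∈ M, ∀ f ∈ M, e ≠ f → c e ≠ c f) ∧
          (∀ k : Fin (n - 2), ∃ e ∈ M, c e = k)) := by
  refine ⟨16 ^ 20, fun n hn => ?_⟩
  have hn0 : n ≠ 0 := by
    have : 0 < 16 ^ 20 := by positivity
    omega
  have hL : 20 ≤ Nat.log 16 n := Nat.le_log_of_pow_le (by norm_num) hn
  obtain ⟨K, hK⟩ : ∃ K, K = (Nat.log 16 n - 4) / 2 := ⟨_, rfl⟩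
  have hK8 : 8 ≤ K := by omega
  have hlo : 16 ^ (2 * K + 4) ≤ n :=
    le_trans (Nat.pow_le_pow_right (by norm_num) (by omega)) (Nat.pow_log_le_self 16 hn0)
  have hhi : n < 16 ^ (2 * K + 6) :=
    lt_of_lt_of_le (Nat.lt_pow_succ_log_self (by norm_num) n)
      (Nat.pow_le_pow_right (by norm_num) (by omega))
  have hn3 : 3 ≤ n := le_trans (by norm_num) hn
  obtain ⟨x, y, f, q, a1, a2, a3, a4, a5, a6, a7, a8⟩ := ABW.numbers n K (by omega) hlo
  obtain ⟨σ, τ, c, b1, b2, b3, b4⟩ :=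
    ABW.comb_cells n (K + 1) q hn3 x y f a1 a2 a3 a4 a5 a6 a7
  obtain ⟨G, c', g1, g2, g3, g4⟩ := ABW.comb_graph n hn3
    ((2 * n + 2 * (n - 2) + 2 * q - (K + 1)) / 4) σ τ c b1 b2 b3 (by
      intro M h1 h2 h3 h4
      have := b4 M h1 h2 h3 h4
      omega)
  have bound : ∀ M : Finset (Sym2 (Fin n ⊕ Fin n)),
          (∀ e ∈ M, e ∈ G.edgeSet) →
          (∀ e ∈ M, ∀ f ∈ M, e ≠ f → ∀ v : Fin n ⊕ Fin n, v ∈ e → v ∉ f) →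
          (∀ e ∈ M, ∀ f ∈ M, e ≠ f → c' e ≠ c' f) →
          16 * M.card + 3 * (K + 1) + 9 ≤ 16 * n := by
    intro M h1 h2 h3
    have h4 := g4 M h1 h2 h3
    have h5 : K + 1 ≤ n := by
      have : 2 * K + 4 < 16 ^ (2 * K + 4) := Nat.lt_pow_self (by norm_num)
      omega
    omega
  refine ⟨G, c', g1, fun v => g2 v, g3, ?_, ?_, ?_⟩
  · have : G.maxDegree ≤ n - 2 := G.maxDegree_le_of_forall_degree_le _ (fun v => (g2 v).le)
    omega
  · rintro ⟨M, h1, h2, h3, h4⟩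
    have h5 := bound M h1 h2 h3
    have h6 := ABW.log_bound n K (by omega) hhi
    have h7 : 16 * (M.card : ℝ) + 3 * (K + 1) + 9 ≤ 16 * n := by exact_mod_cast h5
    linarith
  · rintro ⟨M, h1, h2, h3, h4⟩
    have h5 := bound M h1 h2 h3
    have h6 : n - 2 ≤ M.card := by
      have h7 : (Finset.univ : Finset (Fin (n - 2))) ⊆ M.image c' := by
        intro k _
        obtain ⟨e, he, hk⟩ := h4 k
        exact Finset.mem_image.2 ⟨e, he, hk⟩
      have h8 := (Finset.card_le_card h7).trans Finset.card_image_le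
      simpa using h8
    omega
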